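/- arXiv:1505.06692 — 2 statements merged into one kernel-verified Lean document; each statement's English description precedes it below -/
import Mathlib

section
/- Let l, m, k₁, k₂ be real numbers with k₁ < 0 < k₂. Let E be the 2×2 real matrix E = (1/(k₂ − k₁)) · [[k₂·e^{m/2} − k₁·e^{−m/2}, k₁·k₂·(e^{−m/2} − e^{m/2})], [e^{m/2} − e^{−m/2}, k₂·e^{−m/2} − k₁·e^{m/2}]], and let B = [[e^{−l/2}, 0], [0, e^{l/2}]]. Then trace(E·B) = 2·cosh((m − l)/2) − (2·k₁/(k₂ − k₁)) · ( cosh((m + l)/2) − cosh((m − l)/2) ). -/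
open Matrix Real

/-- The trace identity for the composition of the earthquake matrix `E` (hyperbolic
translation with fixed points `k₁ < 0 < k₂` and translation length `m`) with the
covering transformation `B : z ↦ e^{-l} z`. -/
theorem trace_earthquake_composition
    (l m k₁ k₂ : ℝ) (hk₁ : k₁ < 0) (hk₂ : 0 < k₂)
    (E B : Matrix (Fin 2) (Fin 2) ℝ)
    (hE : E = (k₂ - k₁)⁻¹ •
      !![k₂ * exp (m / 2) - k₁ * exp (-m / 2), k₁ * k₂ * (exp (-m / 2) - exp (m / 2));
         exp (m / 2) - exp (-m / 2), k₂ * exp (-m / 2) - k₁ * exp (m / 2)])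
    (hB : B = !![exp (-l / 2), 0; 0, exp (l / 2)]) :
    (E * B).trace =
      2 * Real.cosh ((m - l) / 2) -
        (2 * k₁ / (k₂ - k₁)) * (Real.cosh ((m + l) / 2) - Real.cosh ((m - l) / 2)) := by
  have hk : k₂ - k₁ ≠ 0 := by linarith
  have h_sub : Real.cosh ((m - l) / 2) =
      (exp (m / 2) * exp (-l / 2) + exp (-m / 2) * exp (l / 2)) / 2 := by
    rw [Real.cosh_eq, ← exp_add, ← exp_add]
    ring_nf
  have h_add : Real.cosh ((m + l) / 2) =
      (exp (m / 2) * exp (l / 2) + exp (-m / 2) * exp (-l / 2)) / 2 := by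
    rw [Real.cosh_eq, ← exp_add, ← exp_add]
    ring_nf
  rw [h_sub, h_add, hE, hB]
  simp only [Matrix.smul_mul, Matrix.trace_smul, Matrix.mul_fin_two, Matrix.trace_fin_two_of,
    smul_eq_mul]
  field_simp
  ring
end

section
/- Let l, m, k₁, k₂ be real numbers with k₁ < 0 < k₂, m ≥ 0 and l ≥ 0. Let E be the 2×2 real matrix E = (1/(k₂ − k₁)) · [[k₂·e^{m/2} − k₁·e^{−m/2}, k₁·k₂·(e^{−m/2} − e^{m/2})], [e^{m/2} − e^{−m/2}, k₂·e^{−m/2} − k₁·e^{m/2}]], and let B = [[e^{−l/2}, 0], [0, e^{l/2}]]. Then trace(E·B) ≥ 2·cosh((m − l)/2), and consequently every real number ℓ ≥ 0 satisfying 2·cosh(ℓ/2) = trace(E·B) satisfies ℓ ≥ m − l. -/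
open Matrix Real

/-- The trace is a weighted average of `2 cosh ((m - l) / 2)` and `2 cosh ((m + l) / 2)`. -/
theorem trace_earthquake_mul_diagonal (l m k₁ k₂ : ℝ) :
    ((k₂ - k₁)⁻¹ •
      !![k₂ * exp (m / 2) - k₁ * exp (-m / 2), k₁ * k₂ * (exp (-m / 2) - exp (m / 2));
         exp (m / 2) - exp (-m / 2), k₂ * exp (-m / 2) - k₁ * exp (m / 2)] *
      !![exp (-l / 2), 0; 0, exp (l / 2)]).trace =
    (k₂ * (2 * Real.cosh ((m - l) / 2)) - k₁ * (2 * Real.cosh ((m + l) / 2))) / (k₂ - k₁) := by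
  have h₁ : (m - l) / 2 = m / 2 + -l / 2 := by ring
  have h₂ : -(m / 2 + -l / 2) = -m / 2 + l / 2 := by ring
  have h₃ : (m + l) / 2 = m / 2 + l / 2 := by ring
  have h₄ : -(m / 2 + l / 2) = -m / 2 + -l / 2 := by ring
  rw [h₁, h₃, Real.cosh_eq, Real.cosh_eq, h₂, h₄]
  simp only [Real.exp_add, Matrix.trace_fin_two, Matrix.smul_mul, Matrix.smul_apply,
    Matrix.mul_apply, Fin.sum_univ_two, Matrix.of_apply, Matrix.cons_val', Matrix.cons_val_zero,
    Matrix.cons_val_one, Matrix.cons_val_fin_one, smul_eq_mul]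
  ring

/-- The trace inequality for the composition of the earthquake matrix with the covering
transformation, and the resulting lower bound on the translation length. -/
theorem trace_earthquake_composition_ge
    (l m k₁ k₂ : ℝ) (hk₁ : k₁ < 0) (hk₂ : 0 < k₂) (hm : 0 ≤ m) (hl : 0 ≤ l)
    (E B : Matrix (Fin 2) (Fin 2) ℝ)
    (hE : E = (k₂ - k₁)⁻¹ •
      !![k₂ * exp (m / 2) - k₁ * exp (-m / 2), k₁ * k₂ * (exp (-m / 2) - exp (m / 2));
         exp (m / 2) - exp (-m / 2), k₂ * exp (-m / 2) - k₁ * exp (m / 2)])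
    (hB : B = !![exp (-l / 2), 0; 0, exp (l / 2)]) :
    2 * Real.cosh ((m - l) / 2) ≤ (E * B).trace ∧
    ∀ ℓ : ℝ, 0 ≤ ℓ → 2 * Real.cosh (ℓ / 2) = (E * B).trace → m - l ≤ ℓ := by
  have htrace : 2 * Real.cosh ((m - l) / 2) ≤ (E * B).trace := by
    have hcosh : Real.cosh ((m - l) / 2) ≤ Real.cosh ((m + l) / 2) := by
      rw [Real.cosh_le_cosh, abs_of_nonneg (by positivity : 0 ≤ (m + l) / 2), abs_le]
      constructor <;> linarith
    rw [hE, hB, trace_earthquake_mul_diagonal, le_div_iff₀ (by linarith)]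
    nlinarith
  refine ⟨htrace, fun ℓ hℓ h => ?_⟩
  have hle : |(m - l) / 2| ≤ |ℓ / 2| := by
    rw [← Real.cosh_le_cosh]
    linarith
  rw [abs_of_nonneg (by positivity : 0 ≤ ℓ / 2)] at hle
  linarith [le_abs_self ((m - l) / 2)]
end
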